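/- Let 𝒢 = {G_1,…,G_g} be a partition of 𝒩 = {1,…,n} with l_min ≤ |G_j| ≤ k for all j, set s_max = ⌊k/l_min⌋, and let ‖z‖_GL := Σ_{j=1}^g ‖z_{G_j}‖₂ be the group LASSO norm. Suppose A ∈ ℝ^{m×n} satisfies GRIP of order 2k with constant δ = δ_{2k} satisfying δ < 1/(1 + √(2·s_max)). Let x ∈ ℝ^n, y = Ax + η with ‖η‖₂ ≤ ε, and let x̂ minimize ‖z‖_GL over all z with ‖y − Az‖₂ ≤ ε. Then ‖x̂ − x‖_GL ≤ 2·(1 + (√(2·s_max)−1)δ)/(1 − (1 + √(2·s_max))δ)·σ_{k,𝒢}(x,‖·‖_GL) + 4√s_max·√(1+δ)/(1 − (1 + √(2·s_max))δ)·ε. -/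

import Mathlib

noncomputable section

open Finset

/-- The restriction `x_Λ` of `x : ℝ^n` to the coordinates in `Λ` (zero outside `Λ`). -/
def restr {n : ℕ} (Λ : Finset (Fin n)) (x : Fin n → ℝ) : Fin n → ℝ :=
  fun i => if i ∈ Λ then x i else 0

/-- The Euclidean norm on `ℝ^n`. -/
def norm2 {n : ℕ} (x : Fin n → ℝ) : ℝ := Real.sqrt (∑ i, (x i) ^ 2)

/-- `Λ` is a group `t`-sparse set: a union of groups of the partition `G`, of cardinality `≤ t`. -/
def GkS {n g : ℕ} (G : Fin g → Finset (Fin n)) (t : ℕ) (Λ : Finset (Fin n)) : Prop :=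
  (∃ S : Finset (Fin g), Λ = S.biUnion G) ∧ Λ.card ≤ t

/-- `A` satisfies the group restricted isometry property of order `t` with constant `δ`. -/
def GRIP {m n g : ℕ} (G : Fin g → Finset (Fin n)) (A : Matrix (Fin m) (Fin n) ℝ)
    (t : ℕ) (δ : ℝ) : Prop :=
  ∀ z : Fin n → ℝ, (∃ Λ : Finset (Fin n), GkS G t Λ ∧ Function.support z ⊆ ↑Λ) →
    (1 - δ) * (norm2 z) ^ 2 ≤ (norm2 (A.mulVec z)) ^ 2 ∧
    (norm2 (A.mulVec z)) ^ 2 ≤ (1 + δ) * (norm2 z) ^ 2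

lemma norm2_eq_norm {n : ℕ} (x : Fin n → ℝ) : norm2 x = ‖WithLp.toLp 2 x‖ := by
  simp [norm2, EuclideanSpace.norm_eq]

lemma norm2_nonneg {n : ℕ} (x : Fin n → ℝ) : 0 ≤ norm2 x := Real.sqrt_nonneg _

lemma norm2_sq {n : ℕ} (x : Fin n → ℝ) : norm2 x ^ 2 = x ⬝ᵥ x := by
  rw [norm2, Real.sq_sqrt (Finset.sum_nonneg fun i _ => sq_nonneg _)]
  simp [dotProduct, sq]

lemma norm2_sub_le {n : ℕ} (x y : Fin n → ℝ) : norm2 (x - y) ≤ norm2 x + norm2 y := by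
  simpa only [norm2_eq_norm, WithLp.toLp_sub] using norm_sub_le (WithLp.toLp 2 x) (WithLp.toLp 2 y)

lemma dotProduct_le_norm2_mul_norm2 {n : ℕ} (x y : Fin n → ℝ) :
    x ⬝ᵥ y ≤ norm2 x * norm2 y :=
  Real.sum_mul_le_sqrt_mul_sqrt _ _ _

lemma restr_sub {n : ℕ} (Λ : Finset (Fin n)) (x y : Fin n → ℝ) :
    restr Λ (x - y) = restr Λ x - restr Λ y := by
  ext i
  by_cases h : i ∈ Λ <;> simp [restr, h]

lemma support_restr_subset {n : ℕ} (Λ : Finset (Fin n)) (x : Fin n → ℝ) :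
    Function.support (restr Λ x) ⊆ ↑Λ := by
  intro i hi
  by_contra h
  exact hi (if_neg h)

lemma restr_dotProduct_restr {n : ℕ} {Λ Λ' : Finset (Fin n)} (h : Disjoint Λ Λ')
    (x : Fin n → ℝ) : restr Λ x ⬝ᵥ restr Λ' x = 0 := by
  refine Finset.sum_eq_zero fun i _ => ?_
  by_cases hi : i ∈ Λ
  · simp [restr, Finset.disjoint_left.mp h hi]
  · simp [restr, hi]

lemma restr_biUnion {n g : ℕ} (G : Fin g → Finset (Fin n))
    (hdisj : ∀ i j : Fin g, i ≠ j → Disjoint (G i) (G j)) (S : Finset (Fin g))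
    (x : Fin n → ℝ) : restr (S.biUnion G) x = ∑ j ∈ S, restr (G j) x := by
  ext i
  rw [Finset.sum_apply]
  by_cases hi : i ∈ S.biUnion G
  · obtain ⟨j, hj, hij⟩ := Finset.mem_biUnion.mp hi
    rw [Finset.sum_eq_single_of_mem j hj]
    · simp only [restr, if_pos hi, if_pos hij]
    · intro l _ hl
      exact if_neg (Finset.disjoint_left.mp (hdisj j l hl.symm) hij)
  · rw [Finset.sum_eq_zero]
    · exact if_neg hi
    · intro j hj
      exact if_neg fun h => hi (Finset.mem_biUnion.mpr ⟨j, hj, h⟩)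

lemma norm2_restr_biUnion_sq {n g : ℕ} (G : Fin g → Finset (Fin n))
    (hdisj : ∀ i j : Fin g, i ≠ j → Disjoint (G i) (G j)) (S : Finset (Fin g))
    (x : Fin n → ℝ) :
    norm2 (restr (S.biUnion G) x) ^ 2 = ∑ j ∈ S, norm2 (restr (G j) x) ^ 2 := by
  rw [norm2_sq, restr_biUnion G hdisj, sum_dotProduct]
  refine Finset.sum_congr rfl fun j hj => ?_
  rw [dotProduct_sum, norm2_sq, Finset.sum_eq_single_of_mem j hj]
  intro l _ hl
  exact restr_dotProduct_restr (hdisj j l hl.symm) x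

lemma sum_norm2_restr_le {n g : ℕ} (G : Fin g → Finset (Fin n))
    (hdisj : ∀ i j : Fin g, i ≠ j → Disjoint (G i) (G j)) (S : Finset (Fin g))
    (x : Fin n → ℝ) :
    ∑ j ∈ S, norm2 (restr (G j) x) ≤ Real.sqrt S.card * norm2 (restr (S.biUnion G) x) := by
  refine le_of_abs_le (abs_le_of_sq_le_sq ?_ (mul_nonneg (Real.sqrt_nonneg _) (norm2_nonneg _)))
  rw [mul_pow, Real.sq_sqrt (Nat.cast_nonneg _), norm2_restr_biUnion_sq G hdisj]
  exact sq_sum_le_card_mul_sum_sq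

lemma card_le_div_of_card_biUnion_le {n g k l : ℕ} (G : Fin g → Finset (Fin n))
    (hdisj : ∀ i j : Fin g, i ≠ j → Disjoint (G i) (G j)) (hl : 0 < l)
    (hG : ∀ i, l ≤ (G i).card) {S : Finset (Fin g)} (hS : (S.biUnion G).card ≤ k) :
    S.card ≤ k / l := by
  rw [Nat.le_div_iff_mul_le hl]
  refine le_trans ?_ hS
  rw [Finset.card_biUnion fun i _ j _ hij => hdisj i j hij]
  simpa using Finset.card_nsmul_le_sum S (fun i => (G i).card) l fun i _ => hG i

/-- Images of orthogonal vectors with a common group sparse support are nearly orthogonal. -/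
lemma GRIP.abs_dotProduct_mulVec_le {m n g t : ℕ} {G : Fin g → Finset (Fin n)}
    {A : Matrix (Fin m) (Fin n) ℝ} {δ : ℝ} (hA : GRIP G A t δ) (hδ : 0 ≤ δ)
    {Λ : Finset (Fin n)} (hΛ : GkS G t Λ) {u v : Fin n → ℝ}
    (hu : Function.support u ⊆ ↑Λ) (hv : Function.support v ⊆ ↑Λ) (huv : u ⬝ᵥ v = 0) :
    |A.mulVec u ⬝ᵥ A.mulVec v| ≤ δ * norm2 u * norm2 v := by
  have hsupp (r : ℝ) : Function.support (u + r • v) ⊆ ↑Λ :=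
    (Function.support_add u (r • v)).trans
      (Set.union_subset hu ((Function.support_const_smul_subset r v).trans hv))
  have hvu : v ⬝ᵥ u = 0 := by rw [dotProduct_comm, huv]
  have key (r : ℝ) : 0 ≤ (δ * norm2 v ^ 2) * (r * r)
      + (-2 * (A.mulVec u ⬝ᵥ A.mulVec v)) * r + δ * norm2 u ^ 2 := by
    have h1 := (hA _ ⟨Λ, hΛ, hsupp r⟩).2
    have h2 := (hA _ ⟨Λ, hΛ, hsupp (-r)⟩).1
    simp only [norm2_sq, Matrix.mulVec_add, Matrix.mulVec_smul, add_dotProduct, dotProduct_add,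
      smul_dotProduct, dotProduct_smul, smul_eq_mul, huv, hvu,
      dotProduct_comm (A.mulVec v) (A.mulVec u)] at h1 h2 ⊢
    linarith
  have hd := discrim_le_zero key
  rw [discrim] at hd
  refine abs_le_of_sq_le_sq ?_ (mul_nonneg (mul_nonneg hδ (norm2_nonneg u)) (norm2_nonneg v))
  linarith

lemma GRIP.norm2_restr_le {m n g k : ℕ} {G : Fin g → Finset (Fin n)}
    (hdisj : ∀ i j : Fin g, i ≠ j → Disjoint (G i) (G j))
    (hcover : Finset.univ.biUnion G = (Finset.univ : Finset (Fin n)))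
    (hG : ∀ i, (G i).card ≤ k) {A : Matrix (Fin m) (Fin n) ℝ} {δ : ℝ}
    (hA : GRIP G A (2 * k) δ) (hδ : 0 ≤ δ) {S : Finset (Fin g)} (hS : (S.biUnion G).card ≤ k)
    (h : Fin n → ℝ) :
    (1 - δ) * norm2 (restr (S.biUnion G) h) ≤
      Real.sqrt (1 + δ) * norm2 (A.mulVec h) + δ * ∑ j ∈ Sᶜ, norm2 (restr (G j) h) := by
  set u := restr (S.biUnion G) h with hu
  have hdec : h = u + ∑ j ∈ Sᶜ, restr (G j) h := by
    rw [hu, restr_biUnion G hdisj, Finset.sum_add_sum_compl, ← restr_biUnion G hdisj, hcover]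
    ext i
    simp [restr]
  have hcross : ∀ j ∈ Sᶜ, -(A.mulVec u ⬝ᵥ A.mulVec (restr (G j) h)) ≤
      δ * norm2 u * norm2 (restr (G j) h) := by
    intro j hj
    have hjS : j ∉ S := Finset.mem_compl.mp hj
    have hsub : (insert j S).biUnion G = G j ∪ S.biUnion G := Finset.biUnion_insert
    have hcard : ((insert j S).biUnion G).card ≤ 2 * k := by
      rw [hsub]
      have := Finset.card_union_le (G j) (S.biUnion G)
      have := hG j
      omega
    refine (neg_le_abs _).trans
      (hA.abs_dotProduct_mulVec_le hδ ⟨⟨insert j S, rfl⟩, hcard⟩ ?_ ?_ ?_)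
    · refine (support_restr_subset _ h).trans ?_
      rw [hsub]
      exact_mod_cast Finset.subset_union_right
    · refine (support_restr_subset _ h).trans ?_
      rw [hsub]
      exact_mod_cast Finset.subset_union_left
    · refine restr_dotProduct_restr ?_ h
      rw [Finset.disjoint_biUnion_left]
      exact fun i hi => hdisj i j fun hij => hjS (hij ▸ hi)
  have hsum := Finset.sum_le_sum hcross
  rw [← Finset.mul_sum, Finset.sum_neg_distrib, ← dotProduct_sum, ← Matrix.mulVec_sum] at hsum
  have hsplit : norm2 (A.mulVec u) ^ 2 = A.mulVec u ⬝ᵥ A.mulVec h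
      - A.mulVec u ⬝ᵥ A.mulVec (∑ j ∈ Sᶜ, restr (G j) h) := by
    rw [norm2_sq]
    conv_rhs => rw [congrArg A.mulVec hdec, Matrix.mulVec_add, dotProduct_add]
    ring
  obtain ⟨hlow, hup⟩ := hA u ⟨_, ⟨⟨S, rfl⟩, hS.trans (by omega)⟩, support_restr_subset _ h⟩
  have hAu : norm2 (A.mulVec u) ≤ Real.sqrt (1 + δ) * norm2 u := by
    refine le_of_abs_le (abs_le_of_sq_le_sq ?_ (mul_nonneg (Real.sqrt_nonneg _) (norm2_nonneg _)))
    rwa [mul_pow, Real.sq_sqrt (by linarith)]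
  have hcs := (dotProduct_le_norm2_mul_norm2 (A.mulVec u) (A.mulVec h)).trans
    (mul_le_mul_of_nonneg_right hAu (norm2_nonneg _))
  rcases (norm2_nonneg u).eq_or_lt with h0 | hpos
  · rw [← h0, mul_zero]
    exact add_nonneg (mul_nonneg (Real.sqrt_nonneg _) (norm2_nonneg _))
      (mul_nonneg hδ (Finset.sum_nonneg fun j _ => norm2_nonneg _))
  · refine le_of_mul_le_mul_right ?_ hpos
    linarith

lemma sum_compl_norm2_restr_le {n g : ℕ} (G : Fin g → Finset (Fin n))
    (hdisj : ∀ i j : Fin g, i ≠ j → Disjoint (G i) (G j)) (S : Finset (Fin g))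
    (x : Fin n → ℝ) :
    ∑ j ∈ Sᶜ, norm2 (restr (G j) x) ≤
      ∑ j, norm2 (restr (G j) (x - restr (S.biUnion G) x)) := by
  refine le_trans (Finset.sum_le_sum fun j hj => le_of_eq ?_)
    (Finset.sum_le_sum_of_subset_of_nonneg (Finset.subset_univ Sᶜ) fun j _ _ => norm2_nonneg _)
  congr 1
  ext i
  by_cases hi : i ∈ G j
  · have hiS : i ∉ S.biUnion G := by
      intro hmem
      obtain ⟨l, hl, hil⟩ := Finset.mem_biUnion.mp hmem
      exact Finset.disjoint_left.mp
        (hdisj l j fun hlj => Finset.mem_compl.mp hj (hlj ▸ hl)) hil hi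
    simp [restr, hi, -Finset.mem_biUnion, hiS]
  · simp [restr, hi]

/-- A vector of smaller group norm differs from `x` mostly on the groups where `x` is large. -/
lemma sum_compl_norm2_restr_sub_le {n g : ℕ} (G : Fin g → Finset (Fin n)) (S : Finset (Fin g))
    {x z : Fin n → ℝ} (hzx : ∑ j, norm2 (restr (G j) z) ≤ ∑ j, norm2 (restr (G j) x)) :
    ∑ j ∈ Sᶜ, norm2 (restr (G j) (z - x)) ≤
      ∑ j ∈ S, norm2 (restr (G j) (z - x)) + 2 * ∑ j ∈ Sᶜ, norm2 (restr (G j) x) := by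
  rw [← Finset.sum_add_sum_compl S, ← Finset.sum_add_sum_compl S] at hzx
  have h1 : ∑ j ∈ S, norm2 (restr (G j) x) ≤
      ∑ j ∈ S, norm2 (restr (G j) z) + ∑ j ∈ S, norm2 (restr (G j) (z - x)) := by
    rw [← Finset.sum_add_distrib]
    refine Finset.sum_le_sum fun j _ => ?_
    simpa [restr_sub] using norm2_sub_le (restr (G j) z) (restr (G j) (z - x))
  have h2 : ∑ j ∈ Sᶜ, norm2 (restr (G j) (z - x)) ≤
      ∑ j ∈ Sᶜ, norm2 (restr (G j) z) + ∑ j ∈ Sᶜ, norm2 (restr (G j) x) := by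
    rw [← Finset.sum_add_distrib]
    refine Finset.sum_le_sum fun j _ => ?_
    simpa [restr_sub] using norm2_sub_le (restr (G j) z) (restr (G j) x)
  linarith

/-- group LASSO, GL-norm bound. -/
theorem stmt14 {m n g k : ℕ} (hk : 0 < k)
    (G : Fin g → Finset (Fin n))
    -- `G` is a partition of `{1,…,n}` with `l_min ≤ |G_j| ≤ k`
    (hne : ∀ i, (G i).Nonempty)
    (hdisj : ∀ i j : Fin g, i ≠ j → Disjoint (G i) (G j))
    (hcover : Finset.univ.biUnion G = (Finset.univ : Finset (Fin n)))
    (lmin : ℕ) (hlmin : 0 < lmin)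
    (hGcard : ∀ i, lmin ≤ (G i).card ∧ (G i).card ≤ k)
    -- `s_max = ⌊k / l_min⌋`
    (smax : ℕ) (hsmax : smax = k / lmin)
    -- the group LASSO norm
    (NGL : (Fin n → ℝ) → ℝ)
    (hNGL : ∀ z, NGL z = ∑ j, norm2 (restr (G j) z))
    -- `A` satisfies GRIP of order `2k` with constant `δ = δ_{2k} < 1/(1+√(2·s_max))`
    (A : Matrix (Fin m) (Fin n) ℝ)
    (δ : ℝ) (hδ0 : 0 < δ) (hδ : δ < 1 / (1 + Real.sqrt (2 * smax)))
    (hGRIP : GRIP G A (2 * k) δ)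
    -- measurements `y = Ax + η`, `‖η‖₂ ≤ ε`
    (x : Fin n → ℝ) (η : Fin m → ℝ) (ε : ℝ) (hε : 0 ≤ ε) (hη : norm2 η ≤ ε)
    (y : Fin m → ℝ) (hy : y = A.mulVec x + η)
    -- `x̂` minimizes `‖z‖_GL` subject to `‖y − Az‖₂ ≤ ε`
    (xh : Fin n → ℝ)
    (hfeas : norm2 (y - A.mulVec xh) ≤ ε)
    (hopt : ∀ z : Fin n → ℝ, norm2 (y - A.mulVec z) ≤ ε → NGL xh ≤ NGL z)
    -- the group `k`-sparsity index `σ = σ_{k,𝒢}(x, ‖·‖_GL)`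
    (σ : ℝ)
    (hσ : σ = sInf {t : ℝ | ∃ Λ : Finset (Fin n), GkS G k Λ ∧ t = NGL (x - restr Λ x)}) :
    NGL (xh - x)
      ≤ 2 * ((1 + (Real.sqrt (2 * smax) - 1) * δ) / (1 - (1 + Real.sqrt (2 * smax)) * δ)) * σ
        + 4 * Real.sqrt smax
          * (Real.sqrt (1 + δ) / (1 - (1 + Real.sqrt (2 * smax)) * δ)) * ε := by
  obtain ⟨Λ, ⟨⟨S, rfl⟩, hcard⟩, hσΛ⟩ :
      σ ∈ {t : ℝ | ∃ Λ : Finset (Fin n), GkS G k Λ ∧ t = NGL (x - restr Λ x)} := by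
    rw [hσ]
    refine Set.Nonempty.csInf_mem ⟨_, ∅, ⟨⟨∅, by simp⟩, by simp⟩, rfl⟩ ?_
    refine (Set.finite_range fun Λ : Finset (Fin n) => NGL (x - restr Λ x)).subset ?_
    rintro _ ⟨Λ, -, rfl⟩
    exact ⟨Λ, rfl⟩
  have hxfeas : norm2 (y - A.mulVec x) ≤ ε := by simpa [hy] using hη
  have hle := hopt x hxfeas
  rw [hNGL, hNGL] at hle
  have hcone := sum_compl_norm2_restr_sub_le G S hle
  have htail := sum_compl_norm2_restr_le G hdisj S x
  rw [← hNGL, ← hσΛ] at htail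
  have hres : norm2 (A.mulVec (xh - x)) ≤ 2 * ε := by
    have := norm2_sub_le (y - A.mulVec x) (y - A.mulVec xh)
    rw [sub_sub_sub_cancel_left, ← Matrix.mulVec_sub] at this
    linarith
  have hmain := hGRIP.norm2_restr_le hdisj hcover (fun i => (hGcard i).2) hδ0.le hcard (xh - x)
  have hhead := sum_norm2_restr_le G hdisj S (xh - x)
  have hScard : Real.sqrt S.card ≤ Real.sqrt smax := by
    refine Real.sqrt_le_sqrt ?_
    rw [hsmax]
    exact_mod_cast card_le_div_of_card_biUnion_le G hdisj hlmin (fun i => (hGcard i).1) hcard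
  have hhead' := hhead.trans (mul_le_mul_of_nonneg_right hScard (norm2_nonneg _))
  rw [hNGL, ← Finset.sum_add_sum_compl S]
  have hv : 0 ≤ ∑ j ∈ Sᶜ, norm2 (restr (G j) (xh - x)) :=
    Finset.sum_nonneg fun j _ => norm2_nonneg _
  have hs2 : Real.sqrt smax ≤ Real.sqrt (2 * smax) :=
    Real.sqrt_le_sqrt (by linarith [Nat.cast_nonneg (α := ℝ) smax])
  have hs := Real.sqrt_nonneg (smax : ℝ)
  have hq := Real.sqrt_nonneg (1 + δ)
  rw [lt_div_iff₀ (by linarith)] at hδ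
  generalize Real.sqrt (2 * smax) = r at *
  generalize Real.sqrt smax = s at *
  generalize Real.sqrt (1 + δ) = q at *
  generalize ∑ j ∈ Sᶜ, norm2 (restr (G j) (xh - x)) = v at *
  generalize ∑ j ∈ S, norm2 (restr (G j) (xh - x)) = u at *
  generalize norm2 (restr (S.biUnion G) (xh - x)) = N at *
  have hD : 0 < 1 - (1 + r) * δ := by linarith
  have hδ1 : 0 ≤ 1 - δ := by nlinarith
  have hN : (1 - δ) * N ≤ q * (2 * ε) + δ * v :=
    hmain.trans (add_le_add_left (mul_le_mul_of_nonneg_left hres hq) _)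
  have hu : (1 - δ) * u ≤ s * (q * (2 * ε)) + r * δ * v := by
    have h1 := mul_le_mul_of_nonneg_left hhead' hδ1
    have h2 := mul_le_mul_of_nonneg_left hN hs
    have h3 := mul_le_mul_of_nonneg_right hs2 (mul_nonneg hδ0.le hv)
    linarith
  have hvσ : v ≤ u + 2 * σ := by linarith
  have hrδ : 0 ≤ r * δ := mul_nonneg (hs.trans hs2) hδ0.le
  have huD : (1 - (1 + r) * δ) * u ≤ 2 * s * q * ε + 2 * (r * δ) * σ := by
    linarith [mul_le_mul_of_nonneg_left hvσ hrδ]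
  have hrhs : 2 * ((1 + (r - 1) * δ) / (1 - (1 + r) * δ)) * σ
      + 4 * s * (q / (1 - (1 + r) * δ)) * ε
      = (2 * (1 + (r - 1) * δ) * σ + 4 * s * q * ε) / (1 - (1 + r) * δ) := by
    ring
  rw [hrhs, le_div_iff₀ hD]
  linarith [mul_le_mul_of_nonneg_right hvσ hD.le]
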